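/- Let H be a finite-dimensional complex vector space, σ : H → H an additive involution with σ(σ(x)) = x and σ(c·x) = c̄·σ(x) for all c ∈ ℂ, x ∈ H, and let B be a nondegenerate alternating bilinear form on H. Let F³ ⊆ F² ⊆ F¹ ⊆ H be subspaces such that F¹ = (F³)^⊥ and F² = (F²)^⊥, where W^⊥ = {x ∈ H : B(y,x) = 0 for all y ∈ W}. Assume that B(ω, σ(ω)) ≠ 0 for every nonzero ω ∈ F³, and that H = F² ⊕ σ(F²). Then also H = F¹ ⊕ σ(F³) and H = F³ ⊕ σ(F¹); that is, the filtration F^• and its conjugate σ(F^•) are 3-opposed. -/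

import Mathlib

/-- If `B` pairs two finite-dimensional subspaces `V` and `S` nondegenerately, then `S` together
with the right orthogonal of `V` spans the whole space. -/
theorem exists_mem_forall_apply_sub_eq_zero {K E : Type*} [Field K] [AddCommGroup E] [Module K E]
    (B : E →ₗ[K] E →ₗ[K] K) (V S : Submodule K E) [FiniteDimensional K V]
    (hV : ∀ v ∈ V, (∀ s ∈ S, B v s = 0) → v = 0)
    (hS : ∀ s ∈ S, (∀ v ∈ V, B v s = 0) → s = 0) (x : E) :
    ∃ s ∈ S, ∀ v ∈ V, B v (x - s) = 0 := by
  let p : V →ₗ[K] S →ₗ[K] K := B.domRestrict₁₂ V S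
  have hp : p.IsPerfPair := by
    refine LinearMap.IsPerfPair.of_injective ?_ ?_
    · refine (injective_iff_map_eq_zero _).2 fun v hv => Subtype.ext (hV v v.2 fun s hs => ?_)
      exact LinearMap.congr_fun hv ⟨s, hs⟩
    · refine (injective_iff_map_eq_zero _).2 fun s hs => Subtype.ext (hS s s.2 fun v hv => ?_)
      exact LinearMap.congr_fun hs ⟨v, hv⟩
  obtain ⟨s, hs⟩ := hp.bijective_right.2 ((B.flip x).domRestrict V)
  refine ⟨s, s.2, fun v hv => ?_⟩
  have h : B v s = B v x := LinearMap.congr_fun hs ⟨v, hv⟩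
  rw [map_sub, h, sub_self]

/-- Abstract form of Corollary 1.6: given a nondegenerate alternating form `B` on a
finite-dimensional complex vector space `H`, a conjugation `σ`, and a filtration
`F³ ⊆ F² ⊆ F¹` with `F¹ = (F³)^⊥` and `F² = (F²)^⊥`, such that `B(ω, σω) ≠ 0` for all
nonzero `ω ∈ F³` and `H = F² ⊕ σ(F²)`, one also has `H = F¹ ⊕ σ(F³)` and `H = F³ ⊕ σ(F¹)`. -/
theorem stmt10 (H : Type*) [AddCommGroup H] [Module ℂ H] [FiniteDimensional ℂ H]
    (σ : H → H)
    (hadd : ∀ x y, σ (x + y) = σ x + σ y)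
    (hinv : ∀ x, σ (σ x) = x)
    (hsmul : ∀ (c : ℂ) (x : H), σ (c • x) = (starRingEnd ℂ c) • σ x)
    (B : H →ₗ[ℂ] H →ₗ[ℂ] ℂ)
    (halt : ∀ x, B x x = 0)
    (hnd : ∀ x, (∀ y, B x y = 0) → x = 0)
    (F₁ F₂ F₃ : Submodule ℂ H) (h32 : F₃ ≤ F₂) (h21 : F₂ ≤ F₁)
    (hF₁ : ∀ x, x ∈ F₁ ↔ ∀ y ∈ F₃, B y x = 0)
    (hF₂ : ∀ x, x ∈ F₂ ↔ ∀ y ∈ F₂, B y x = 0)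
    (hpos : ∀ ω ∈ F₃, ω ≠ 0 → B ω (σ ω) ≠ 0)
    (hsplit : ((F₂ : Set H) ∩ (σ '' (F₂ : Set H)) = {0}) ∧
      ∀ x : H, ∃ u ∈ F₂, ∃ y ∈ F₂, x = u + σ y) :
    (((F₁ : Set H) ∩ (σ '' (F₃ : Set H)) = {0}) ∧
      ∀ x : H, ∃ u ∈ F₁, ∃ y ∈ F₃, x = u + σ y) ∧
    (((F₃ : Set H) ∩ (σ '' (F₁ : Set H)) = {0}) ∧
      ∀ x : H, ∃ u ∈ F₃, ∃ y ∈ F₁, x = u + σ y) := by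
  have hzero : σ 0 = 0 := by simpa using hsmul 0 0
  have hdisj : ∀ ω ∈ F₃, σ ω ∈ F₁ → ω = 0 := fun ω hω h =>
    by_contra fun hne => hpos ω hω hne ((hF₁ _).1 h ω hω)
  let S : Submodule ℂ H :=
    { carrier := σ '' F₃
      add_mem' := by
        rintro _ _ ⟨a, ha, rfl⟩ ⟨b, hb, rfl⟩
        exact ⟨a + b, F₃.add_mem ha hb, hadd a b⟩
      zero_mem' := ⟨0, F₃.zero_mem, hzero⟩
      smul_mem' := by
        rintro c _ ⟨a, ha, rfl⟩
        exact ⟨starRingEnd ℂ c • a, F₃.smul_mem _ ha, by simp [hsmul]⟩ }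
  have hspan : ∀ x : H, ∃ u ∈ F₁, ∃ y ∈ F₃, x = u + σ y := by
    intro x
    obtain ⟨_, ⟨y, hy, rfl⟩, h⟩ := exists_mem_forall_apply_sub_eq_zero B F₃ S
      (fun v hv h => by_contra fun hne => hpos v hv hne (h _ ⟨v, hv, rfl⟩))
      (by
        rintro _ ⟨a, ha, rfl⟩ h
        rw [hdisj a ha ((hF₁ _).2 h), hzero]) x
    exact ⟨x - σ y, (hF₁ _).2 h, y, hy, (sub_add_cancel _ _).symm⟩
  refine ⟨⟨?_, hspan⟩, ?_, fun x => ?_⟩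
  · refine Set.Subset.antisymm ?_ ?_
    · rintro _ ⟨h, y, hy, rfl⟩
      rw [hdisj y hy h, hzero]
      rfl
    · rintro _ rfl
      exact ⟨F₁.zero_mem, 0, F₃.zero_mem, hzero⟩
  · refine Set.Subset.antisymm ?_ ?_
    · rintro _ ⟨h, y, hy, rfl⟩
      exact hdisj _ h ((hinv y).symm ▸ hy)
    · rintro _ rfl
      exact ⟨F₃.zero_mem, 0, F₁.zero_mem, hzero⟩
  · obtain ⟨u, hu, y, hy, h⟩ := hspan (σ x)
    exact ⟨y, hy, u, hu, by rw [← hinv x, h, hadd, hinv, add_comm]⟩
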